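/- arXiv:1310.8323 — 4 statements merged into one kernel-verified Lean document; each statement's English description precedes it below -/
import Mathlib

section
/- Let (H, μ, Δ, α_H) be a Hom-bialgebra with α_H bijective, and let (M, α_M), (N, α_N), (P, α_P) be Yetter-Drinfeld modules over H with bijective structure maps. Then the maps c_{X,Y}: X⊗Y → Y⊗X, c_{X,Y}(x⊗y) = α_Y^{-1}(α_H^{-1}(x_{(-1)})·y)⊗α_X^{-1}(x_{(0)}), satisfy the braid relation: (id_P⊗c_{M,N}) ∘ (c_{M,P}⊗id_N) ∘ (id_M⊗c_{N,P}) = (c_{N,P}⊗id_M) ∘ (id_N⊗c_{M,P}) ∘ (c_{M,N}⊗id_P) as maps M⊗N⊗P → P⊗N⊗M. -/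
open TensorProduct

noncomputable section

namespace HomYD

variable (k : Type*) [Field k]
variable {H M N : Type*}
variable [AddCommGroup H] [Module k H]
variable [AddCommGroup M] [Module k M]
variable [AddCommGroup N] [Module k N]

/-- Rearrangement `(a ⊗ b) ⊗ c ↦ (a ⊗ c) ⊗ b`. -/
def rearr (A B C : Type*) [AddCommGroup A] [Module k A] [AddCommGroup B] [Module k B]
    [AddCommGroup C] [Module k C] :
    (A ⊗[k] B) ⊗[k] C →ₗ[k] (A ⊗[k] C) ⊗[k] B :=
  (TensorProduct.assoc k A C B).symm.toLinearMap ∘ₗ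
    (TensorProduct.map LinearMap.id (TensorProduct.comm k B C).toLinearMap) ∘ₗ
      (TensorProduct.assoc k A B C).toLinearMap

/-- Middle-four exchange `(a ⊗ b) ⊗ (c ⊗ d) ↦ (a ⊗ c) ⊗ (b ⊗ d)`. -/
def ttc (A B C D : Type*) [AddCommGroup A] [Module k A] [AddCommGroup B] [Module k B]
    [AddCommGroup C] [Module k C] [AddCommGroup D] [Module k D] :
    (A ⊗[k] B) ⊗[k] (C ⊗[k] D) →ₗ[k] (A ⊗[k] C) ⊗[k] (B ⊗[k] D) :=
  (TensorProduct.tensorTensorTensorComm k A B C D).toLinearMap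

/-- Hom-bialgebra (no unit/counit): multiplicativity of `α`, Hom-associativity,
comultiplicativity of `α`, Hom-coassociativity, and `Δ` multiplicative. -/
structure IsHomBialgebra (μ : H ⊗[k] H →ₗ[k] H) (Δ : H →ₗ[k] H ⊗[k] H)
    (α : H →ₗ[k] H) : Prop where
  mul_mult : ∀ a b : H, α (μ (a ⊗ₜ[k] b)) = μ (α a ⊗ₜ[k] α b)
  hom_assoc : ∀ a b c : H, μ (α a ⊗ₜ[k] μ (b ⊗ₜ[k] c)) = μ (μ (a ⊗ₜ[k] b) ⊗ₜ[k] α c)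
  comul_compat : TensorProduct.map α α ∘ₗ Δ = Δ ∘ₗ α
  hom_coassoc : (TensorProduct.assoc k H H H).toLinearMap ∘ₗ TensorProduct.map Δ α ∘ₗ Δ
      = TensorProduct.map α Δ ∘ₗ Δ
  comul_mul : Δ ∘ₗ μ
      = TensorProduct.map μ μ ∘ₗ ttc k H H H H ∘ₗ TensorProduct.map Δ Δ

/-- Left module over a Hom-(bi)algebra. -/
structure IsHomModule (μ : H ⊗[k] H →ₗ[k] H) (α : H →ₗ[k] H)
    (ρ : H ⊗[k] M →ₗ[k] M) (αM : M →ₗ[k] M) : Prop where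
  str_compat : ∀ (h : H) (m : M), αM (ρ (h ⊗ₜ[k] m)) = ρ (α h ⊗ₜ[k] αM m)
  hom_smul : ∀ (h h' : H) (m : M),
      ρ (α h ⊗ₜ[k] ρ (h' ⊗ₜ[k] m)) = ρ (μ (h ⊗ₜ[k] h') ⊗ₜ[k] αM m)

/-- Left comodule over a Hom-(bi)algebra. -/
structure IsHomComodule (Δ : H →ₗ[k] H ⊗[k] H) (α : H →ₗ[k] H)
    (lM : M →ₗ[k] H ⊗[k] M) (αM : M →ₗ[k] M) : Prop where
  str_compat : TensorProduct.map α αM ∘ₗ lM = lM ∘ₗ αM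
  hom_coact : TensorProduct.map Δ αM ∘ₗ lM
      = (TensorProduct.assoc k H H M).symm.toLinearMap ∘ₗ TensorProduct.map α lM ∘ₗ lM

/-- `h ⊗ m ↦ (h₁·m)₍₋₁₎ β(h₂) ⊗ (h₁·m)₍₀₎`. -/
def ydL (μ : H ⊗[k] H →ₗ[k] H) (Δ : H →ₗ[k] H ⊗[k] H) (β : H →ₗ[k] H)
    (ρ : H ⊗[k] M →ₗ[k] M) (lM : M →ₗ[k] H ⊗[k] M) : H ⊗[k] M →ₗ[k] H ⊗[k] M :=
  TensorProduct.map μ LinearMap.id ∘ₗ rearr k H M H ∘ₗ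
    TensorProduct.map (lM ∘ₗ ρ) β ∘ₗ rearr k H H M ∘ₗ
      TensorProduct.map Δ LinearMap.id

/-- `h ⊗ m ↦ β(h₁) γ(m₍₋₁₎) ⊗ γ(h₂)·m₍₀₎`. -/
def ydR (μ : H ⊗[k] H →ₗ[k] H) (Δ : H →ₗ[k] H ⊗[k] H) (β γ : H →ₗ[k] H)
    (ρ : H ⊗[k] M →ₗ[k] M) (lM : M →ₗ[k] H ⊗[k] M) : H ⊗[k] M →ₗ[k] H ⊗[k] M :=
  TensorProduct.map (μ ∘ₗ TensorProduct.map β γ) (ρ ∘ₗ TensorProduct.map γ LinearMap.id) ∘ₗ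
    ttc k H H H M ∘ₗ TensorProduct.map Δ lM

/-- Yetter-Drinfeld module over a Hom-bialgebra: Hom-module, Hom-comodule and the
compatibility `(h₁·m)₍₋₁₎ α²(h₂) ⊗ (h₁·m)₍₀₎ = α²(h₁) α(m₍₋₁₎) ⊗ α(h₂)·m₍₀₎`. -/
def IsYetterDrinfeld (μ : H ⊗[k] H →ₗ[k] H) (Δ : H →ₗ[k] H ⊗[k] H) (α : H →ₗ[k] H)
    (ρ : H ⊗[k] M →ₗ[k] M) (lM : M →ₗ[k] H ⊗[k] M) (αM : M →ₗ[k] M) : Prop :=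
  IsHomModule k μ α ρ αM ∧ IsHomComodule k Δ α lM αM ∧
    ydL k μ Δ (α ∘ₗ α) ρ lM = ydR k μ Δ (α ∘ₗ α) α ρ lM

/-- `m ⊗ n ↦ αHinv(m₍₋₁₎)·n ⊗ m₍₀₎`. -/
def Bmap (αHinv : H →ₗ[k] H) (lM : M →ₗ[k] H ⊗[k] M) (ρN : H ⊗[k] N →ₗ[k] N) :
    M ⊗[k] N →ₗ[k] N ⊗[k] M :=
  TensorProduct.map (ρN ∘ₗ TensorProduct.map αHinv LinearMap.id) LinearMap.id ∘ₗ
    rearr k H M N ∘ₗ TensorProduct.map lM LinearMap.id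

/-- Quasi-braiding `m ⊗ n ↦ αN⁻¹(αH⁻¹(m₍₋₁₎)·n) ⊗ αM⁻¹(m₍₀₎)`. -/
def braidYD (αH : H ≃ₗ[k] H) (αM : M ≃ₗ[k] M) (αN : N ≃ₗ[k] N)
    (lM : M →ₗ[k] H ⊗[k] M) (ρN : H ⊗[k] N →ₗ[k] N) : M ⊗[k] N →ₗ[k] N ⊗[k] M :=
  TensorProduct.map
      (αN.symm.toLinearMap ∘ₗ ρN ∘ₗ TensorProduct.map αH.symm.toLinearMap LinearMap.id)
      αM.symm.toLinearMap ∘ₗ rearr k H M N ∘ₗ TensorProduct.map lM LinearMap.id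

/-- Action on `M ⊗ N`: `h ⊗ (m ⊗ n) ↦ h₁·m ⊗ h₂·n`. -/
def hatAction (Δ : H →ₗ[k] H ⊗[k] H)
    (ρM : H ⊗[k] M →ₗ[k] M) (ρN : H ⊗[k] N →ₗ[k] N) :
    H ⊗[k] (M ⊗[k] N) →ₗ[k] M ⊗[k] N :=
  TensorProduct.map ρM ρN ∘ₗ ttc k H H M N ∘ₗ TensorProduct.map Δ LinearMap.id

/-- Coaction on `M ⊗ N`: `m ⊗ n ↦ αHinv²(m₍₋₁₎ n₍₋₁₎) ⊗ (m₍₀₎ ⊗ n₍₀₎)`. -/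
def hatCoaction (μ : H ⊗[k] H →ₗ[k] H) (αHinv : H →ₗ[k] H)
    (lM : M →ₗ[k] H ⊗[k] M) (lN : N →ₗ[k] H ⊗[k] N) :
    M ⊗[k] N →ₗ[k] H ⊗[k] (M ⊗[k] N) :=
  TensorProduct.map (αHinv ∘ₗ αHinv ∘ₗ μ) LinearMap.id ∘ₗ ttc k H M H N ∘ₗ
    TensorProduct.map lM lN

/-- Action on `M ⊗ N`: `h ⊗ (m ⊗ n) ↦ αHinv²(h₁)·m ⊗ αHinv²(h₂)·n`. -/
def tildeAction (Δ : H →ₗ[k] H ⊗[k] H) (αHinv : H →ₗ[k] H)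
    (ρM : H ⊗[k] M →ₗ[k] M) (ρN : H ⊗[k] N →ₗ[k] N) :
    H ⊗[k] (M ⊗[k] N) →ₗ[k] M ⊗[k] N :=
  TensorProduct.map ρM ρN ∘ₗ ttc k H H M N ∘ₗ
    TensorProduct.map
      (TensorProduct.map (αHinv ∘ₗ αHinv) (αHinv ∘ₗ αHinv) ∘ₗ Δ) LinearMap.id

/-- Coaction on `M ⊗ N`: `m ⊗ n ↦ m₍₋₁₎ n₍₋₁₎ ⊗ (m₍₀₎ ⊗ n₍₀₎)`. -/
def tildeCoaction (μ : H ⊗[k] H →ₗ[k] H)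
    (lM : M →ₗ[k] H ⊗[k] M) (lN : N →ₗ[k] H ⊗[k] N) :
    M ⊗[k] N →ₗ[k] H ⊗[k] (M ⊗[k] N) :=
  TensorProduct.map μ LinearMap.id ∘ₗ ttc k H M H N ∘ₗ TensorProduct.map lM lN

/-- Associator `(x ⊗ y) ⊗ z ↦ αX⁻¹(x) ⊗ (y ⊗ αZ(z))`. -/
def aYD {X Z : Type*} [AddCommGroup X] [Module k X] [AddCommGroup Z] [Module k Z]
    (αX : X ≃ₗ[k] X) (Y : Type*) [AddCommGroup Y] [Module k Y] (αZ : Z ≃ₗ[k] Z) :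
    (X ⊗[k] Y) ⊗[k] Z →ₗ[k] X ⊗[k] (Y ⊗[k] Z) :=
  (TensorProduct.assoc k X Y Z).toLinearMap ∘ₗ
    TensorProduct.map (TensorProduct.map αX.symm.toLinearMap LinearMap.id) αZ.toLinearMap

/-- Inverse associator `x ⊗ (y ⊗ z) ↦ (αX(x) ⊗ y) ⊗ αZ⁻¹(z)`. -/
def aYDinv {X Z : Type*} [AddCommGroup X] [Module k X] [AddCommGroup Z] [Module k Z]
    (αX : X ≃ₗ[k] X) (Y : Type*) [AddCommGroup Y] [Module k Y] (αZ : Z ≃ₗ[k] Z) :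
    X ⊗[k] (Y ⊗[k] Z) →ₗ[k] (X ⊗[k] Y) ⊗[k] Z :=
  TensorProduct.map (TensorProduct.map αX.toLinearMap LinearMap.id) αZ.symm.toLinearMap ∘ₗ
    (TensorProduct.assoc k X Y Z).symm.toLinearMap

/-- Associator `(x ⊗ y) ⊗ z ↦ αX(x) ⊗ (y ⊗ αZ⁻¹(z))`. -/
def aTilde {X Z : Type*} [AddCommGroup X] [Module k X] [AddCommGroup Z] [Module k Z]
    (αX : X ≃ₗ[k] X) (Y : Type*) [AddCommGroup Y] [Module k Y] (αZ : Z ≃ₗ[k] Z) :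
    (X ⊗[k] Y) ⊗[k] Z →ₗ[k] X ⊗[k] (Y ⊗[k] Z) :=
  (TensorProduct.assoc k X Y Z).toLinearMap ∘ₗ
    TensorProduct.map (TensorProduct.map αX.toLinearMap LinearMap.id) αZ.symm.toLinearMap

/-- Inverse associator `x ⊗ (y ⊗ z) ↦ (αX⁻¹(x) ⊗ y) ⊗ αZ(z)`. -/
def aTildeInv {X Z : Type*} [AddCommGroup X] [Module k X] [AddCommGroup Z] [Module k Z]
    (αX : X ≃ₗ[k] X) (Y : Type*) [AddCommGroup Y] [Module k Y] (αZ : Z ≃ₗ[k] Z) :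
    X ⊗[k] (Y ⊗[k] Z) →ₗ[k] (X ⊗[k] Y) ⊗[k] Z :=
  TensorProduct.map (TensorProduct.map αX.symm.toLinearMap LinearMap.id) αZ.toLinearMap ∘ₗ
    (TensorProduct.assoc k X Y Z).symm.toLinearMap

/-- Quasitriangular Hom-bialgebra. -/
def IsQuasitriangular (μ : H ⊗[k] H →ₗ[k] H) (Δ : H →ₗ[k] H ⊗[k] H) (α : H →ₗ[k] H)
    (R : H ⊗[k] H) : Prop :=
  IsHomBialgebra k μ Δ α ∧
  TensorProduct.map Δ α R
    = TensorProduct.map (TensorProduct.map α α) μ (ttc k H H H H (R ⊗ₜ[k] R)) ∧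
  TensorProduct.map α Δ R
    = TensorProduct.map μ (TensorProduct.map α α ∘ₗ (TensorProduct.comm k H H).toLinearMap)
        (ttc k H H H H (R ⊗ₜ[k] R)) ∧
  ∀ h : H, TensorProduct.map μ μ (ttc k H H H H ((TensorProduct.comm k H H (Δ h)) ⊗ₜ[k] R))
      = TensorProduct.map μ μ (ttc k H H H H (R ⊗ₜ[k] Δ h))

/-- Coaction induced by an R-matrix: `m ↦ α(R²) ⊗ R¹·m`. -/
def coactionFromR (R : H ⊗[k] H) (α : H →ₗ[k] H) (ρM : H ⊗[k] M →ₗ[k] M) :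
    M →ₗ[k] H ⊗[k] M :=
  (TensorProduct.comm k M H).toLinearMap ∘ₗ TensorProduct.map ρM α ∘ₗ rearr k H H M ∘ₗ
    TensorProduct.mk k (H ⊗[k] H) M R

/-- Quasi-braiding from an R-matrix: `m ⊗ n ↦ αN⁻¹(R²·n) ⊗ αM⁻¹(R¹·m)`. -/
def braidR (R : H ⊗[k] H) (ρM : H ⊗[k] M →ₗ[k] M) (ρN : H ⊗[k] N →ₗ[k] N)
    (αM : M ≃ₗ[k] M) (αN : N ≃ₗ[k] N) : M ⊗[k] N →ₗ[k] N ⊗[k] M :=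
  TensorProduct.map αN.symm.toLinearMap αM.symm.toLinearMap ∘ₗ
    (TensorProduct.comm k M N).toLinearMap ∘ₗ TensorProduct.map ρM ρN ∘ₗ
      ttc k H H M N ∘ₗ TensorProduct.mk k (H ⊗[k] H) (M ⊗[k] N) R

/-- Coquasitriangular Hom-bialgebra. -/
def IsCoquasitriangular (μ : H ⊗[k] H →ₗ[k] H) (Δ : H →ₗ[k] H ⊗[k] H) (α : H →ₗ[k] H)
    (σ : H ⊗[k] H →ₗ[k] k) : Prop :=
  IsHomBialgebra k μ Δ α ∧
  (∀ x y z : H, σ (μ (x ⊗ₜ[k] y) ⊗ₜ[k] α z)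
      = LinearMap.mul' k k
          (TensorProduct.map σ σ (ttc k H H H H ((α x ⊗ₜ[k] α y) ⊗ₜ[k] Δ z)))) ∧
  (∀ x y z : H, σ (α x ⊗ₜ[k] μ (y ⊗ₜ[k] z))
      = LinearMap.mul' k k
          (TensorProduct.map σ σ (ttc k H H H H (Δ x ⊗ₜ[k] (α z ⊗ₜ[k] α y))))) ∧
  (∀ x y : H,
      (TensorProduct.rid k H)
        (TensorProduct.map (μ ∘ₗ (TensorProduct.comm k H H).toLinearMap) σ
          (ttc k H H H H (Δ x ⊗ₜ[k] Δ y)))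
      = (TensorProduct.lid k H)
          (TensorProduct.map σ μ (ttc k H H H H (Δ x ⊗ₜ[k] Δ y))))

/-- Action induced by a coquasitriangular form: `h ⊗ m ↦ σ(m₍₋₁₎ ⊗ α(h)) • m₍₀₎`. -/
def actionFromSigma (σ : H ⊗[k] H →ₗ[k] k) (α : H →ₗ[k] H)
    (lM : M →ₗ[k] H ⊗[k] M) : H ⊗[k] M →ₗ[k] M :=
  (TensorProduct.lid k M).toLinearMap ∘ₗ
    TensorProduct.map (σ ∘ₗ TensorProduct.map LinearMap.id α ∘ₗ
        (TensorProduct.comm k H H).toLinearMap) LinearMap.id ∘ₗ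
      (TensorProduct.assoc k H H M).symm.toLinearMap ∘ₗ
        TensorProduct.map LinearMap.id lM

/-- Quasi-braiding from a coquasitriangular form:
`m ⊗ n ↦ σ(n₍₋₁₎ ⊗ m₍₋₁₎) • (αN⁻¹(n₍₀₎) ⊗ αM⁻¹(m₍₀₎))`. -/
def braidSigma (σ : H ⊗[k] H →ₗ[k] k)
    (lM : M →ₗ[k] H ⊗[k] M) (lN : N →ₗ[k] H ⊗[k] N)
    (αM : M ≃ₗ[k] M) (αN : N ≃ₗ[k] N) : M ⊗[k] N →ₗ[k] N ⊗[k] M :=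
  (TensorProduct.lid k (N ⊗[k] M)).toLinearMap ∘ₗ
    TensorProduct.map (σ ∘ₗ (TensorProduct.comm k H H).toLinearMap)
      (TensorProduct.map αN.symm.toLinearMap αM.symm.toLinearMap ∘ₗ
        (TensorProduct.comm k M N).toLinearMap) ∘ₗ
      ttc k H M H N ∘ₗ TensorProduct.map lM lN


theorem rearr_tmul {A B C : Type*} [AddCommGroup A] [Module k A] [AddCommGroup B] [Module k B]
    [AddCommGroup C] [Module k C] (a : A) (b : B) (c : C) :
    rearr k A B C ((a ⊗ₜ b) ⊗ₜ c) = (a ⊗ₜ c) ⊗ₜ b := by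
  simp [rearr]

theorem ttc_tmul {A B C D : Type*} [AddCommGroup A] [Module k A] [AddCommGroup B] [Module k B]
    [AddCommGroup C] [Module k C] [AddCommGroup D] [Module k D] (a : A) (b : B) (c : C) (d : D) :
    ttc k A B C D ((a ⊗ₜ b) ⊗ₜ (c ⊗ₜ d)) = (a ⊗ₜ c) ⊗ₜ (b ⊗ₜ d) := by
  simp [ttc]

theorem braidYD_tmul (αH : H ≃ₗ[k] H) (αM : M ≃ₗ[k] M) (αN : N ≃ₗ[k] N)
    (lM : M →ₗ[k] H ⊗[k] M) (ρN : H ⊗[k] N →ₗ[k] N) (m : M) (n : N) :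
    braidYD k αH αM αN lM ρN (m ⊗ₜ n) =
      TensorProduct.map
        (αN.symm.toLinearMap ∘ₗ ρN ∘ₗ TensorProduct.map αH.symm.toLinearMap LinearMap.id)
        αM.symm.toLinearMap (rearr k H M N (lM m ⊗ₜ n)) := by
  simp [braidYD]

section Symm

variable {k} {μ : H ⊗[k] H →ₗ[k] H} {Δ : H →ₗ[k] H ⊗[k] H} {αH : H ≃ₗ[k] H}

theorem IsHomBialgebra.symm_mul (hH : IsHomBialgebra k μ Δ αH.toLinearMap) (a b : H) :
    αH.symm (μ (a ⊗ₜ b)) = μ (αH.symm a ⊗ₜ αH.symm b) := by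
  rw [LinearEquiv.symm_apply_eq]
  simpa using (hH.mul_mult (αH.symm a) (αH.symm b)).symm

theorem IsHomBialgebra.comul_symm (hH : IsHomBialgebra k μ Δ αH.toLinearMap) (h : H) :
    Δ (αH.symm h) = TensorProduct.map αH.symm.toLinearMap αH.symm.toLinearMap (Δ h) := by
  have key := LinearMap.congr_fun hH.comul_compat (αH.symm h)
  simp only [LinearMap.comp_apply, LinearEquiv.coe_coe, LinearEquiv.apply_symm_apply] at key
  rw [← key, ← LinearMap.comp_apply, ← TensorProduct.map_comp]
  simp

variable {ρ : H ⊗[k] M →ₗ[k] M} {lM : M →ₗ[k] H ⊗[k] M} {αM : M ≃ₗ[k] M}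

theorem IsHomModule.symm_smul (hM : IsHomModule k μ αH.toLinearMap ρ αM.toLinearMap)
    (h : H) (m : M) : αM.symm (ρ (h ⊗ₜ m)) = ρ (αH.symm h ⊗ₜ αM.symm m) := by
  rw [LinearEquiv.symm_apply_eq]
  simpa using (hM.str_compat (αH.symm h) (αM.symm m)).symm

theorem IsHomModule.smul_smul (hM : IsHomModule k μ αH.toLinearMap ρ αM.toLinearMap)
    (h h' : H) (m : M) : ρ (h ⊗ₜ ρ (h' ⊗ₜ m)) = ρ (μ (αH.symm h ⊗ₜ h') ⊗ₜ αM m) := by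
  simpa using hM.hom_smul (αH.symm h) h' m

theorem IsHomComodule.coact_symm (hM : IsHomComodule k Δ αH.toLinearMap lM αM.toLinearMap)
    (m : M) : lM (αM.symm m) =
      TensorProduct.map αH.symm.toLinearMap αM.symm.toLinearMap (lM m) := by
  have key := LinearMap.congr_fun hM.str_compat (αM.symm m)
  simp only [LinearMap.comp_apply, LinearEquiv.coe_coe, LinearEquiv.apply_symm_apply] at key
  rw [← key, ← LinearMap.comp_apply, ← TensorProduct.map_comp]
  simp

/-- Hom-coassociativity solved for the iterated coaction:
`m₍₋₁₎ ⊗ m₍₀₎₍₋₁₎ ⊗ m₍₀₎₍₀₎ = α⁻¹(m₍₋₁₎₁) ⊗ m₍₋₁₎₂ ⊗ αM(m₍₀₎)`. -/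
theorem IsHomComodule.coact_coact (hM : IsHomComodule k Δ αH.toLinearMap lM αM.toLinearMap)
    (m : M) : TensorProduct.map LinearMap.id lM (lM m) =
      TensorProduct.assoc k H H M
        (TensorProduct.map (TensorProduct.map αH.symm.toLinearMap LinearMap.id ∘ₗ Δ)
          αM.toLinearMap (lM m)) := by
  have key := LinearMap.congr_fun hM.hom_coact m
  have step : TensorProduct.map (TensorProduct.map αH.symm.toLinearMap LinearMap.id ∘ₗ Δ)
      αM.toLinearMap (lM m) = TensorProduct.map
        (TensorProduct.map αH.symm.toLinearMap LinearMap.id) LinearMap.id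
        (TensorProduct.map Δ αM.toLinearMap (lM m)) := by
    rw [TensorProduct.map_map, LinearMap.id_comp]
  rw [step]
  simp only [LinearMap.comp_apply] at key
  rw [key]
  generalize lM m = s
  induction s with
  | zero => simp
  | add x y hx hy => simp only [map_add, hx, hy]
  | tmul h m =>
    simp only [TensorProduct.map_tmul, LinearMap.id_apply, LinearEquiv.coe_coe]
    generalize lM m = r
    induction r with
    | zero => simp
    | add x y hx hy => simp only [map_add, TensorProduct.tmul_add, hx, hy]
    | tmul h m => simp

end Symm

section BraidRelation

variable {k} {P : Type*} [AddCommGroup P] [Module k P]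

/-- `b ⊗ n ↦ α⁻⁴(b)·αP⁻¹(p) ⊗ αN⁻²(n)`. -/
def braidKernel (αH : H ≃ₗ[k] H) (αN : N ≃ₗ[k] N) (αP : P ≃ₗ[k] P)
    (ρP : H ⊗[k] P →ₗ[k] P) (p : P) : H ⊗[k] N →ₗ[k] P ⊗[k] N :=
  TensorProduct.map
    (ρP ∘ₗ (TensorProduct.mk k H P).flip (αP.symm p) ∘ₗ
      αH.symm.toLinearMap ∘ₗ αH.symm.toLinearMap ∘ₗ αH.symm.toLinearMap ∘ₗ αH.symm.toLinearMap)
    (αN.symm.toLinearMap ∘ₗ αN.symm.toLinearMap)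

/-- `(g ⊗ (h ⊗ m)) ⊗ (b ⊗ n) ↦ α⁻³(g b)·αP⁻¹(p) ⊗ (α⁻³(h)·αN⁻²(n) ⊗ αM⁻²(m))`. -/
def braidLeft (μ : H ⊗[k] H →ₗ[k] H) (αH : H ≃ₗ[k] H) (αM : M ≃ₗ[k] M) (αN : N ≃ₗ[k] N)
    (αP : P ≃ₗ[k] P) (ρN : H ⊗[k] N →ₗ[k] N) (ρP : H ⊗[k] P →ₗ[k] P) (p : P) :
    (H ⊗[k] (H ⊗[k] M)) ⊗[k] (H ⊗[k] N) →ₗ[k] P ⊗[k] (N ⊗[k] M) :=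
  TensorProduct.map
    (ρP ∘ₗ (TensorProduct.mk k H P).flip (αP.symm p) ∘ₗ
      αH.symm.toLinearMap ∘ₗ αH.symm.toLinearMap ∘ₗ αH.symm.toLinearMap ∘ₗ μ)
    (TensorProduct.map
      (αN.symm.toLinearMap ∘ₗ αN.symm.toLinearMap ∘ₗ ρN ∘ₗ
        TensorProduct.map αH.symm.toLinearMap LinearMap.id)
      (αM.symm.toLinearMap ∘ₗ αM.symm.toLinearMap) ∘ₗ rearr k H M N) ∘ₗ
    ttc k H (H ⊗[k] M) H N

/-- `g ⊗ (h ⊗ m) ↦ α⁻⁴(x₍₋₁₎ h)·αP⁻¹(p) ⊗ (αN⁻²(x₍₀₎) ⊗ αM⁻²(m))` with `x = α⁻¹(g)·n`. -/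
def braidRight (μ : H ⊗[k] H →ₗ[k] H) (αH : H ≃ₗ[k] H) (αM : M ≃ₗ[k] M) (αN : N ≃ₗ[k] N)
    (αP : P ≃ₗ[k] P) (ρN : H ⊗[k] N →ₗ[k] N) (lN : N →ₗ[k] H ⊗[k] N)
    (ρP : H ⊗[k] P →ₗ[k] P) (n : N) (p : P) :
    H ⊗[k] (H ⊗[k] M) →ₗ[k] P ⊗[k] (N ⊗[k] M) :=
  (TensorProduct.assoc k P N M).toLinearMap ∘ₗ
    TensorProduct.map
      (braidKernel αH αN αP ρP p ∘ₗ TensorProduct.map μ LinearMap.id ∘ₗ rearr k H N H ∘ₗ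
        TensorProduct.map
          (lN ∘ₗ ρN ∘ₗ (TensorProduct.mk k H N).flip n ∘ₗ αH.symm.toLinearMap) LinearMap.id)
      (αM.symm.toLinearMap ∘ₗ αM.symm.toLinearMap) ∘ₗ
    (TensorProduct.assoc k H H M).symm.toLinearMap

variable {μ : H ⊗[k] H →ₗ[k] H} {Δ : H →ₗ[k] H ⊗[k] H} {αH : H ≃ₗ[k] H}
  {lM : M →ₗ[k] H ⊗[k] M} {αM : M ≃ₗ[k] M}
  {ρN : H ⊗[k] N →ₗ[k] N} {lN : N →ₗ[k] H ⊗[k] N} {αN : N ≃ₗ[k] N}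
  {ρP : H ⊗[k] P →ₗ[k] P} {lP : P →ₗ[k] H ⊗[k] P} {αP : P ≃ₗ[k] P}

theorem braid_left_apply (hH : IsHomBialgebra k μ Δ αH.toLinearMap)
    (hM : IsHomComodule k Δ αH.toLinearMap lM αM.toLinearMap)
    (hN : IsHomModule k μ αH.toLinearMap ρN αN.toLinearMap)
    (hP : IsHomModule k μ αH.toLinearMap ρP αP.toLinearMap) (m : M) (n : N) (p : P) :
    TensorProduct.map (LinearMap.id : P →ₗ[k] P) (braidYD k αH αM αN lM ρN)
      (TensorProduct.assoc k P M N
        (TensorProduct.map (braidYD k αH αM αP lM ρP) (LinearMap.id : N →ₗ[k] N)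
          ((TensorProduct.assoc k M P N).symm
            (TensorProduct.map (LinearMap.id : M →ₗ[k] M) (braidYD k αH αN αP lN ρP)
              (m ⊗ₜ (n ⊗ₜ p)))))) =
      braidLeft μ αH αM αN αP ρN ρP p
        (TensorProduct.map LinearMap.id lM (lM m) ⊗ₜ lN n) := by
  simp only [TensorProduct.map_tmul, LinearMap.id_apply, braidYD_tmul]
  generalize lN n = t
  induction t with
  | zero => simp
  | add x y hx hy => simp only [map_add, TensorProduct.tmul_add, TensorProduct.add_tmul, hx, hy]
  | tmul b n =>
    simp only [rearr_tmul, TensorProduct.map_tmul, TensorProduct.assoc_symm_tmul, braidYD_tmul,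
      LinearMap.id_apply]
    generalize lM m = s
    induction s with
    | zero => simp
    | add x y hx hy =>
      simp only [map_add, TensorProduct.add_tmul, hx, hy]
    | tmul g m =>
      simp only [rearr_tmul, TensorProduct.map_tmul, TensorProduct.assoc_tmul, braidYD_tmul,
        LinearMap.id_apply, LinearEquiv.coe_coe, hM.coact_symm]
      generalize lM m = r
      induction r with
      | zero => simp
      | add x y hx hy =>
        simp only [map_add, TensorProduct.tmul_add, TensorProduct.add_tmul, hx, hy]
      | tmul h m =>
        simp [braidLeft, rearr_tmul, ttc_tmul, hN.symm_smul, hP.symm_smul, hP.smul_smul,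
          hH.symm_mul]

theorem braid_right_apply (hH : IsHomBialgebra k μ Δ αH.toLinearMap)
    (hM : IsHomComodule k Δ αH.toLinearMap lM αM.toLinearMap)
    (hN : IsHomComodule k Δ αH.toLinearMap lN αN.toLinearMap)
    (hP : IsHomModule k μ αH.toLinearMap ρP αP.toLinearMap) (m : M) (n : N) (p : P) :
    TensorProduct.assoc k P N M
      (TensorProduct.map (braidYD k αH αN αP lN ρP) (LinearMap.id : M →ₗ[k] M)
        ((TensorProduct.assoc k N P M).symm
          (TensorProduct.map (LinearMap.id : N →ₗ[k] N) (braidYD k αH αM αP lM ρP)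
            (TensorProduct.assoc k N M P
              (TensorProduct.map (braidYD k αH αM αN lM ρN) (LinearMap.id : P →ₗ[k] P)
                ((m ⊗ₜ n) ⊗ₜ p)))))) =
      braidRight μ αH αM αN αP ρN lN ρP n p (TensorProduct.map LinearMap.id lM (lM m)) := by
  simp only [TensorProduct.map_tmul, LinearMap.id_apply, braidYD_tmul]
  generalize lM m = s
  induction s with
  | zero => simp
  | add x y hx hy => simp only [map_add, TensorProduct.add_tmul, hx, hy]
  | tmul g m =>
    simp only [rearr_tmul, TensorProduct.map_tmul, TensorProduct.assoc_tmul, braidYD_tmul,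
      LinearMap.id_apply, LinearEquiv.coe_coe, hM.coact_symm]
    generalize lM m = r
    induction r with
    | zero => simp
    | add x y hx hy =>
      simp only [map_add, TensorProduct.tmul_add, TensorProduct.add_tmul, hx, hy]
    | tmul h m =>
      simp only [rearr_tmul, TensorProduct.map_tmul, TensorProduct.assoc_symm_tmul, braidYD_tmul,
        LinearMap.id_apply, LinearEquiv.coe_coe, hN.coact_symm, braidRight, LinearMap.comp_apply,
        LinearMap.flip_apply, TensorProduct.mk_apply]
      generalize lN (ρN (αH.symm g ⊗ₜ n)) = t
      induction t with
      | zero => simp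
      | add x y hx hy =>
        simp only [map_add, TensorProduct.add_tmul, hx, hy]
      | tmul b n =>
        simp [braidKernel, rearr_tmul, hP.symm_smul, hP.smul_smul, hH.symm_mul]

theorem braidLeft_eq_ydR (hH : IsHomBialgebra k μ Δ αH.toLinearMap)
    (hN : IsHomModule k μ αH.toLinearMap ρN αN.toLinearMap) (h : H) (m : M) (n : N) (p : P) :
    braidLeft μ αH αM αN αP ρN ρP p
      (TensorProduct.assoc k H H M
        (TensorProduct.map αH.symm.toLinearMap LinearMap.id (Δ h) ⊗ₜ αM m) ⊗ₜ lN n) =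
      TensorProduct.assoc k P N M
        (braidKernel αH αN αP ρP p
          (ydR k μ Δ (αH.toLinearMap ∘ₗ αH.toLinearMap) αH.toLinearMap ρN lN
            (αH.symm (αH.symm h) ⊗ₜ n)) ⊗ₜ αM.symm m) := by
  simp only [ydR, LinearMap.comp_apply, TensorProduct.map_tmul, hH.comul_symm]
  generalize Δ h = t
  generalize lN n = s
  induction t with
  | zero => simp
  | add x y hx hy => simp only [map_add, TensorProduct.add_tmul, hx, hy]
  | tmul g h =>
    induction s with
    | zero => simp
    | add x y hx hy => simp only [map_add, TensorProduct.tmul_add, TensorProduct.add_tmul, hx, hy]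
    | tmul b n =>
      simp [braidLeft, braidKernel, rearr_tmul, ttc_tmul, hN.symm_smul, hH.symm_mul]

theorem braidRight_eq_ydL (hH : IsHomBialgebra k μ Δ αH.toLinearMap) (h : H) (m : M) (n : N)
    (p : P) :
    braidRight μ αH αM αN αP ρN lN ρP n p
      (TensorProduct.assoc k H H M
        (TensorProduct.map αH.symm.toLinearMap LinearMap.id (Δ h) ⊗ₜ αM m)) =
      TensorProduct.assoc k P N M
        (braidKernel αH αN αP ρP p
          (ydL k μ Δ (αH.toLinearMap ∘ₗ αH.toLinearMap) ρN lN
            (αH.symm (αH.symm h) ⊗ₜ n)) ⊗ₜ αM.symm m) := by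
  simp only [ydL, LinearMap.comp_apply, TensorProduct.map_tmul, hH.comul_symm]
  generalize Δ h = t
  induction t with
  | zero => simp
  | add x y hx hy => simp only [map_add, TensorProduct.add_tmul, hx, hy]
  | tmul g h => simp [braidRight, rearr_tmul]

end BraidRelation

/-- the quasi-braidings `c_{X,Y}(x⊗y) = αY⁻¹(αH⁻¹(x₍₋₁₎)·y) ⊗ αX⁻¹(x₍₀₎)`
satisfy the braid relation. -/
theorem stmt8 {k H M N P : Type*} [Field k]
    [AddCommGroup H] [Module k H] [AddCommGroup M] [Module k M]
    [AddCommGroup N] [Module k N] [AddCommGroup P] [Module k P]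
    (μ : H ⊗[k] H →ₗ[k] H) (Δ : H →ₗ[k] H ⊗[k] H) (αH : H ≃ₗ[k] H)
    (hH : IsHomBialgebra k μ Δ αH.toLinearMap)
    (ρM : H ⊗[k] M →ₗ[k] M) (lM : M →ₗ[k] H ⊗[k] M) (αM : M ≃ₗ[k] M)
    (hM : IsYetterDrinfeld k μ Δ αH.toLinearMap ρM lM αM.toLinearMap)
    (ρN : H ⊗[k] N →ₗ[k] N) (lN : N →ₗ[k] H ⊗[k] N) (αN : N ≃ₗ[k] N)
    (hN : IsYetterDrinfeld k μ Δ αH.toLinearMap ρN lN αN.toLinearMap)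
    (ρP : H ⊗[k] P →ₗ[k] P) (lP : P →ₗ[k] H ⊗[k] P) (αP : P ≃ₗ[k] P)
    (hP : IsYetterDrinfeld k μ Δ αH.toLinearMap ρP lP αP.toLinearMap) :
    TensorProduct.map (LinearMap.id : P →ₗ[k] P) (braidYD k αH αM αN lM ρN) ∘ₗ
        (TensorProduct.assoc k P M N).toLinearMap ∘ₗ
          TensorProduct.map (braidYD k αH αM αP lM ρP) (LinearMap.id : N →ₗ[k] N) ∘ₗ
            (TensorProduct.assoc k M P N).symm.toLinearMap ∘ₗ
              TensorProduct.map (LinearMap.id : M →ₗ[k] M) (braidYD k αH αN αP lN ρP)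
      = (TensorProduct.assoc k P N M).toLinearMap ∘ₗ
          TensorProduct.map (braidYD k αH αN αP lN ρP) (LinearMap.id : M →ₗ[k] M) ∘ₗ
            (TensorProduct.assoc k N P M).symm.toLinearMap ∘ₗ
              TensorProduct.map (LinearMap.id : N →ₗ[k] N) (braidYD k αH αM αP lM ρP) ∘ₗ
                (TensorProduct.assoc k N M P).toLinearMap ∘ₗ
                  TensorProduct.map (braidYD k αH αM αN lM ρN) (LinearMap.id : P →ₗ[k] P) ∘ₗ
                    (TensorProduct.assoc k M N P).symm.toLinearMap := by
  refine TensorProduct.ext_threefold' fun m n p => ?_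
  simp only [LinearMap.comp_apply, LinearEquiv.coe_coe, TensorProduct.assoc_symm_tmul]
  rw [braid_left_apply hH hM.2.1 hN.1 hP.1, braid_right_apply hH hM.2.1 hN.2.1 hP.1,
    hM.2.1.coact_coact]
  generalize lM m = s
  induction s with
  | zero => simp
  | add x y hx hy => simp only [map_add, TensorProduct.add_tmul, hx, hy]
  | tmul h m =>
    simp only [TensorProduct.map_tmul, LinearMap.comp_apply, LinearEquiv.coe_coe]
    rw [braidLeft_eq_ydR hH hN.1, braidRight_eq_ydL hH, hN.2.2]

end HomYD
end
end

section
/- Let M, N, P be vector spaces over a field k, let α_M: M→M, α_N: N→N, α_P: P→P be linear maps, and let c_{M,N}: M⊗N→N⊗M, c_{M,P}: M⊗P→P⊗M, c_{N,P}: N⊗P→P⊗N be linear maps satisfying (α_N⊗α_M)∘c_{M,N} = c_{M,N}∘(α_M⊗α_N), (α_P⊗α_M)∘c_{M,P} = c_{M,P}∘(α_M⊗α_P), (α_P⊗α_N)∘c_{N,P} = c_{N,P}∘(α_N⊗α_P), and the braid relation (id_P⊗c_{M,N})∘(c_{M,P}⊗id_N)∘(id_M⊗c_{N,P}) = (c_{N,P}⊗id_M)∘(id_N⊗c_{M,P})∘(c_{M,N}⊗id_P).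 Define B_{M,N} := (α_N⊗α_M)∘c_{M,N}, B_{M,P} := (α_P⊗α_M)∘c_{M,P}, B_{N,P} := (α_P⊗α_N)∘c_{N,P}. Then (α_N⊗α_M)∘B_{M,N} = B_{M,N}∘(α_M⊗α_N), (α_P⊗α_M)∘B_{M,P} = B_{M,P}∘(α_M⊗α_P), (α_P⊗α_N)∘B_{N,P} = B_{N,P}∘(α_N⊗α_P), and the Hom-Yang-Baxter equation holds: (α_P⊗B_{M,N})∘(B_{M,P}⊗α_N)∘(α_M⊗B_{N,P}) = (B_{N,P}⊗α_M)∘(α_N⊗B_{M,P})∘(B_{M,N}⊗α_P). -/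
open TensorProduct

noncomputable section

namespace HomYD

variable (k : Type*) [Field k]
variable {H M N : Type*}
variable [AddCommGroup H] [Module k H]
variable [AddCommGroup M] [Module k M]
variable [AddCommGroup N] [Module k N]

/-- An intertwiner `c` of `f` and `f'` remains one after tensoring on the left with `g`. -/
theorem map_id_map_apply {k A X Y : Type*} [Field k] [AddCommGroup A] [Module k A]
    [AddCommGroup X] [Module k X] [AddCommGroup Y] [Module k Y]
    {g : A →ₗ[k] A} {f : X →ₗ[k] X} {f' : Y →ₗ[k] Y} {c : X →ₗ[k] Y}
    (h : f' ∘ₗ c = c ∘ₗ f) (x : A ⊗[k] X) :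
    TensorProduct.map LinearMap.id c (TensorProduct.map g f x)
      = TensorProduct.map g f' (TensorProduct.map LinearMap.id c x) := by
  simp only [← LinearMap.comp_apply, ← TensorProduct.map_comp, h, LinearMap.id_comp,
    LinearMap.comp_id]

/-- An intertwiner `c` of `f` and `f'` remains one after tensoring on the right with `g`. -/
theorem map_map_id_apply {k A X Y : Type*} [Field k] [AddCommGroup A] [Module k A]
    [AddCommGroup X] [Module k X] [AddCommGroup Y] [Module k Y]
    {g : A →ₗ[k] A} {f : X →ₗ[k] X} {f' : Y →ₗ[k] Y} {c : X →ₗ[k] Y}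
    (h : f' ∘ₗ c = c ∘ₗ f) (x : X ⊗[k] A) :
    TensorProduct.map c LinearMap.id (TensorProduct.map f g x)
      = TensorProduct.map f' g (TensorProduct.map c LinearMap.id x) := by
  simp only [← LinearMap.comp_apply, ← TensorProduct.map_comp, h, LinearMap.id_comp,
    LinearMap.comp_id]

theorem map_comp_right_apply {k A B X Y Z : Type*} [Field k] [AddCommGroup A] [Module k A]
    [AddCommGroup B] [Module k B] [AddCommGroup X] [Module k X] [AddCommGroup Y] [Module k Y]
    [AddCommGroup Z] [Module k Z]
    (g : A →ₗ[k] B) (f : Y →ₗ[k] Z) (c : X →ₗ[k] Y) (x : A ⊗[k] X) :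
    TensorProduct.map g (f ∘ₗ c) x
      = TensorProduct.map g f (TensorProduct.map LinearMap.id c x) := by
  simp only [← LinearMap.comp_apply, ← TensorProduct.map_comp, LinearMap.comp_id]

theorem map_comp_left_apply {k A B X Y Z : Type*} [Field k] [AddCommGroup A] [Module k A]
    [AddCommGroup B] [Module k B] [AddCommGroup X] [Module k X] [AddCommGroup Y] [Module k Y]
    [AddCommGroup Z] [Module k Z]
    (g : A →ₗ[k] B) (f : Y →ₗ[k] Z) (c : X →ₗ[k] Y) (x : X ⊗[k] A) :
    TensorProduct.map (f ∘ₗ c) g x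
      = TensorProduct.map f g (TensorProduct.map c LinearMap.id x) := by
  simp only [← LinearMap.comp_apply, ← TensorProduct.map_comp, LinearMap.comp_id]

/-- if maps `c` commute with the `α`'s and satisfy the braid relation, then
`B := (α ⊗ α) ∘ c` satisfies the corresponding commutations and the Hom-Yang-Baxter
equation. -/
theorem stmt9 {k M N P : Type*} [Field k]
    [AddCommGroup M] [Module k M] [AddCommGroup N] [Module k N] [AddCommGroup P] [Module k P]
    (αM : M →ₗ[k] M) (αN : N →ₗ[k] N) (αP : P →ₗ[k] P)
    (cMN : M ⊗[k] N →ₗ[k] N ⊗[k] M) (cMP : M ⊗[k] P →ₗ[k] P ⊗[k] M)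
    (cNP : N ⊗[k] P →ₗ[k] P ⊗[k] N)
    (h1 : TensorProduct.map αN αM ∘ₗ cMN = cMN ∘ₗ TensorProduct.map αM αN)
    (h2 : TensorProduct.map αP αM ∘ₗ cMP = cMP ∘ₗ TensorProduct.map αM αP)
    (h3 : TensorProduct.map αP αN ∘ₗ cNP = cNP ∘ₗ TensorProduct.map αN αP)
    (hbraid : TensorProduct.map (LinearMap.id : P →ₗ[k] P) cMN ∘ₗ
        (TensorProduct.assoc k P M N).toLinearMap ∘ₗ
          TensorProduct.map cMP (LinearMap.id : N →ₗ[k] N) ∘ₗ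
            (TensorProduct.assoc k M P N).symm.toLinearMap ∘ₗ
              TensorProduct.map (LinearMap.id : M →ₗ[k] M) cNP
      = (TensorProduct.assoc k P N M).toLinearMap ∘ₗ
          TensorProduct.map cNP (LinearMap.id : M →ₗ[k] M) ∘ₗ
            (TensorProduct.assoc k N P M).symm.toLinearMap ∘ₗ
              TensorProduct.map (LinearMap.id : N →ₗ[k] N) cMP ∘ₗ
                (TensorProduct.assoc k N M P).toLinearMap ∘ₗ
                  TensorProduct.map cMN (LinearMap.id : P →ₗ[k] P) ∘ₗ
                    (TensorProduct.assoc k M N P).symm.toLinearMap) :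
    (TensorProduct.map αN αM ∘ₗ (TensorProduct.map αN αM ∘ₗ cMN)
      = (TensorProduct.map αN αM ∘ₗ cMN) ∘ₗ TensorProduct.map αM αN) ∧
    (TensorProduct.map αP αM ∘ₗ (TensorProduct.map αP αM ∘ₗ cMP)
      = (TensorProduct.map αP αM ∘ₗ cMP) ∘ₗ TensorProduct.map αM αP) ∧
    (TensorProduct.map αP αN ∘ₗ (TensorProduct.map αP αN ∘ₗ cNP)
      = (TensorProduct.map αP αN ∘ₗ cNP) ∘ₗ TensorProduct.map αN αP) ∧
    (TensorProduct.map αP (TensorProduct.map αN αM ∘ₗ cMN) ∘ₗ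
        (TensorProduct.assoc k P M N).toLinearMap ∘ₗ
          TensorProduct.map (TensorProduct.map αP αM ∘ₗ cMP) αN ∘ₗ
            (TensorProduct.assoc k M P N).symm.toLinearMap ∘ₗ
              TensorProduct.map αM (TensorProduct.map αP αN ∘ₗ cNP)
      = (TensorProduct.assoc k P N M).toLinearMap ∘ₗ
          TensorProduct.map (TensorProduct.map αP αN ∘ₗ cNP) αM ∘ₗ
            (TensorProduct.assoc k N P M).symm.toLinearMap ∘ₗ
              TensorProduct.map αN (TensorProduct.map αP αM ∘ₗ cMP) ∘ₗ
                (TensorProduct.assoc k N M P).toLinearMap ∘ₗ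
                  TensorProduct.map (TensorProduct.map αN αM ∘ₗ cMN) αP ∘ₗ
                    (TensorProduct.assoc k M N P).symm.toLinearMap) := by
  refine ⟨by rw [LinearMap.comp_assoc, h1], by rw [LinearMap.comp_assoc, h2],
    by rw [LinearMap.comp_assoc, h3], ?_⟩
  refine LinearMap.ext fun x => ?_
  have hx := LinearMap.congr_fun hbraid x
  simp only [LinearMap.comp_apply, LinearEquiv.coe_coe, map_comp_right_apply,
    map_comp_left_apply] at hx ⊢
  simp only [← TensorProduct.map_map_assoc, ← TensorProduct.map_map_assoc_symm,
    map_id_map_apply h1, map_id_map_apply h2, map_map_id_apply h2, map_map_id_apply h3, hx]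

end HomYD
end
end

section
/- Let V be a vector space over a field k, let c: V⊗V → V⊗V be a linear map satisfying the braid relation (id_V⊗c)∘(c⊗id_V)∘(id_V⊗c) = (c⊗id_V)∘(id_V⊗c)∘(c⊗id_V), and let α: V→V be a linear map such that (α⊗α)∘c = c∘(α⊗α). Then the linear map B := (α⊗α)∘c: V⊗V → V⊗V satisfies (α⊗α)∘B = B∘(α⊗α) and the Hom-braid relation (α⊗B)∘(B⊗α)∘(α⊗B) = (B⊗α)∘(α⊗B)∘(B⊗α). -/
open TensorProduct

noncomputable section

namespace HomYD

variable (k : Type*) [Field k]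
variable {H M N : Type*}
variable [AddCommGroup H] [Module k H]
variable [AddCommGroup M] [Module k M]
variable [AddCommGroup N] [Module k N]

/-- In a monoid, twisting two elements satisfying the braid relation by an element commuting
with both preserves the braid relation. -/
theorem braid_mul_left_of_commute {E : Type*} [Monoid E] {a p q : E} (hp : Commute a p)
    (hq : Commute a q) (h : p * q * p = q * p * q) :
    (a * p) * (a * q) * (a * p) = (a * q) * (a * p) * (a * q) := by
  have key {x y : E} (hx : Commute a x) (hy : Commute a y) :
      (a * x) * (a * y) * (a * x) = a ^ 3 * (x * y * x) := by
    rw [hx.symm.mul_mul_mul_comm a y, (hx.mul_right hy).symm.mul_mul_mul_comm (a * a) x,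
      ← pow_two, ← pow_succ]
  rw [key hp hq, key hq hp, h]

/-- if `c : V ⊗ V → V ⊗ V` satisfies the braid relation and commutes with
`α ⊗ α`, then `B := (α ⊗ α) ∘ c` commutes with `α ⊗ α` and satisfies the Hom-braid
relation. -/
theorem stmt10 {k V : Type*} [Field k] [AddCommGroup V] [Module k V]
    (c : V ⊗[k] V →ₗ[k] V ⊗[k] V) (α : V →ₗ[k] V)
    (hbraid : TensorProduct.map (LinearMap.id : V →ₗ[k] V) c ∘ₗ
        (TensorProduct.assoc k V V V).toLinearMap ∘ₗ
          TensorProduct.map c (LinearMap.id : V →ₗ[k] V) ∘ₗ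
            (TensorProduct.assoc k V V V).symm.toLinearMap ∘ₗ
              TensorProduct.map (LinearMap.id : V →ₗ[k] V) c
      = (TensorProduct.assoc k V V V).toLinearMap ∘ₗ
          TensorProduct.map c (LinearMap.id : V →ₗ[k] V) ∘ₗ
            (TensorProduct.assoc k V V V).symm.toLinearMap ∘ₗ
              TensorProduct.map (LinearMap.id : V →ₗ[k] V) c ∘ₗ
                (TensorProduct.assoc k V V V).toLinearMap ∘ₗ
                  TensorProduct.map c (LinearMap.id : V →ₗ[k] V) ∘ₗ
                    (TensorProduct.assoc k V V V).symm.toLinearMap)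
    (hc : TensorProduct.map α α ∘ₗ c = c ∘ₗ TensorProduct.map α α) :
    (TensorProduct.map α α ∘ₗ (TensorProduct.map α α ∘ₗ c)
      = (TensorProduct.map α α ∘ₗ c) ∘ₗ TensorProduct.map α α) ∧
    (TensorProduct.map α (TensorProduct.map α α ∘ₗ c) ∘ₗ
        (TensorProduct.assoc k V V V).toLinearMap ∘ₗ
          TensorProduct.map (TensorProduct.map α α ∘ₗ c) α ∘ₗ
            (TensorProduct.assoc k V V V).symm.toLinearMap ∘ₗ
              TensorProduct.map α (TensorProduct.map α α ∘ₗ c)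
      = (TensorProduct.assoc k V V V).toLinearMap ∘ₗ
          TensorProduct.map (TensorProduct.map α α ∘ₗ c) α ∘ₗ
            (TensorProduct.assoc k V V V).symm.toLinearMap ∘ₗ
              TensorProduct.map α (TensorProduct.map α α ∘ₗ c) ∘ₗ
                (TensorProduct.assoc k V V V).toLinearMap ∘ₗ
                  TensorProduct.map (TensorProduct.map α α ∘ₗ c) α ∘ₗ
                    (TensorProduct.assoc k V V V).symm.toLinearMap) := by
  refine ⟨by rw [LinearMap.comp_assoc, ← hc], ?_⟩
  let a : Module.End k (V ⊗[k] (V ⊗[k] V)) := TensorProduct.map α (TensorProduct.map α α)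
  let p : Module.End k (V ⊗[k] (V ⊗[k] V)) := TensorProduct.map LinearMap.id c
  let q : Module.End k (V ⊗[k] (V ⊗[k] V)) := (TensorProduct.assoc k V V V).toLinearMap ∘ₗ
    TensorProduct.map c LinearMap.id ∘ₗ (TensorProduct.assoc k V V V).symm.toLinearMap
  have a_assoc : a ∘ₗ (TensorProduct.assoc k V V V).toLinearMap
      = (TensorProduct.assoc k V V V).toLinearMap ∘ₗ
        TensorProduct.map (TensorProduct.map α α) α := TensorProduct.map_map_comp_assoc_eq α α α
  have assoc_symm_a : (TensorProduct.assoc k V V V).symm.toLinearMap ∘ₗ a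
      = TensorProduct.map (TensorProduct.map α α) α ∘ₗ
        (TensorProduct.assoc k V V V).symm.toLinearMap :=
    (TensorProduct.map_map_comp_assoc_symm_eq α α α).symm
  have hap : a * p = TensorProduct.map α (TensorProduct.map α α ∘ₗ c) := by
    change a ∘ₗ p = _
    rw [← TensorProduct.map_comp, LinearMap.comp_id]
  have haq : a * q = (TensorProduct.assoc k V V V).toLinearMap ∘ₗ
      TensorProduct.map (TensorProduct.map α α ∘ₗ c) α ∘ₗ
        (TensorProduct.assoc k V V V).symm.toLinearMap := by
    change a ∘ₗ (_ ∘ₗ _ ∘ₗ _) = _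
    rw [← LinearMap.comp_assoc, a_assoc, LinearMap.comp_assoc, ← LinearMap.comp_assoc _ _
      (TensorProduct.map (TensorProduct.map α α) α), ← TensorProduct.map_comp, LinearMap.comp_id]
  have hp : Commute a p := by
    change a * p = p ∘ₗ a
    rw [hap, ← TensorProduct.map_comp, LinearMap.id_comp, hc]
  have hq : Commute a q := by
    change a * q = ((TensorProduct.assoc k V V V).toLinearMap ∘ₗ
      TensorProduct.map c LinearMap.id ∘ₗ (TensorProduct.assoc k V V V).symm.toLinearMap) ∘ₗ a
    rw [haq, LinearMap.comp_assoc, LinearMap.comp_assoc, assoc_symm_a, ← LinearMap.comp_assoc _ _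
      (TensorProduct.map c LinearMap.id), ← TensorProduct.map_comp, LinearMap.id_comp, hc]
  have h := braid_mul_left_of_commute hp hq hbraid
  rw [hap, haq] at h
  exact h

end HomYD
end
end

section
/- Let (H, μ, Δ, α_H, R) be a quasitriangular Hom-bialgebra with α_H bijective and (α_H⊗α_H)(R) = R, and let (M, α_M), (N, α_N) be left H-modules. Give M and N the coactions λ_M(m) = α_H(R²)⊗R¹·m and λ_N(n) = α_H(r²)⊗r¹·n (R = R¹⊗R² = r¹⊗r²), and give M⊗N the standard action h·(m⊗n) = h₁·m⊗h₂·n and the coaction λ_{M⊗N}(m⊗n) = α_H(R²)⊗R¹·(m⊗n) = α_H(R²)⊗(R¹₁·m⊗R¹₂·n). Then λ_{M⊗N} coincides with the ⊗̂ coaction built from λ_M and λ_N; explicitly, α_H^{-2}(α_H(R²)α_H(r²)) ⊗ (R¹·m ⊗ r¹·n) = α_H(R²) ⊗ (R¹₁·m ⊗ R¹₂·n) for all m∈M, n∈N. -/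
open TensorProduct

noncomputable section

namespace HomYD

variable (k : Type*) [Field k]
variable {H M N : Type*}
variable [AddCommGroup H] [Module k H]
variable [AddCommGroup M] [Module k M]
variable [AddCommGroup N] [Module k N]

/-- The map `(a ⊗ b) ⊗ c ↦ c ⊗ (a·m ⊗ b·n)`. -/
def actOnPair (ρM : H ⊗[k] M →ₗ[k] M) (ρN : H ⊗[k] N →ₗ[k] N) (m : M) (n : N) :
    (H ⊗[k] H) ⊗[k] H →ₗ[k] H ⊗[k] (M ⊗[k] N) :=
  (TensorProduct.comm k (M ⊗[k] N) H).toLinearMap ∘ₗ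
    TensorProduct.map
      (TensorProduct.map (ρM ∘ₗ (TensorProduct.mk k H M).flip m)
        (ρN ∘ₗ (TensorProduct.mk k H N).flip n)) LinearMap.id

lemma coactionFromR_tmul (a b : H) (α : H →ₗ[k] H) (ρM : H ⊗[k] M →ₗ[k] M) (m : M) :
    coactionFromR k (a ⊗ₜ[k] b) α ρM m = α b ⊗ₜ[k] ρM (a ⊗ₜ[k] m) := by
  simp [coactionFromR, rearr]

lemma coactionFromR_zero (α : H →ₗ[k] H) (ρM : H ⊗[k] M →ₗ[k] M) (m : M) :
    coactionFromR k 0 α ρM m = 0 := by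
  simp [coactionFromR]

lemma coactionFromR_add (P Q : H ⊗[k] H) (α : H →ₗ[k] H) (ρM : H ⊗[k] M →ₗ[k] M) (m : M) :
    coactionFromR k (P + Q) α ρM m = coactionFromR k P α ρM m + coactionFromR k Q α ρM m := by
  simp [coactionFromR]

lemma coactionFromR_hatAction (Δ : H →ₗ[k] H ⊗[k] H) (α : H →ₗ[k] H)
    (ρM : H ⊗[k] M →ₗ[k] M) (ρN : H ⊗[k] N →ₗ[k] N) (P : H ⊗[k] H) (m : M) (n : N) :
    coactionFromR k P α (hatAction k Δ ρM ρN) (m ⊗ₜ[k] n)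
      = actOnPair k ρM ρN m n (TensorProduct.map Δ α P) := by
  induction P with
  | zero => simp [coactionFromR_zero]
  | add P Q hP hQ => simp only [coactionFromR_add, map_add, hP, hQ]
  | tmul a b =>
    suffices h : ∀ x : H ⊗[k] H, TensorProduct.map ρM ρN (ttc k H H M N (x ⊗ₜ[k] (m ⊗ₜ[k] n)))
        = TensorProduct.map (ρM ∘ₗ (TensorProduct.mk k H M).flip m)
            (ρN ∘ₗ (TensorProduct.mk k H N).flip n) x by
      simp [coactionFromR_tmul, hatAction, actOnPair, h]
    intro x
    induction x with
    | zero => simp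
    | add x y hx hy => simp only [TensorProduct.add_tmul, map_add, hx, hy]
    | tmul c d => simp [ttc]

lemma hatCoaction_coactionFromR_map (μ : H ⊗[k] H →ₗ[k] H) (α : H ≃ₗ[k] H)
    (hμ : ∀ a b : H, α (μ (a ⊗ₜ[k] b)) = μ (α a ⊗ₜ[k] α b))
    (ρM : H ⊗[k] M →ₗ[k] M) (ρN : H ⊗[k] N →ₗ[k] N) (P Q : H ⊗[k] H) (m : M) (n : N) :
    hatCoaction k μ α.symm.toLinearMap
        (coactionFromR k (TensorProduct.map α.toLinearMap α.toLinearMap P) α.toLinearMap ρM)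
        (coactionFromR k (TensorProduct.map α.toLinearMap α.toLinearMap Q) α.toLinearMap ρN)
        (m ⊗ₜ[k] n)
      = actOnPair k ρM ρN m n
          (TensorProduct.map (TensorProduct.map α.toLinearMap α.toLinearMap) μ
            (ttc k H H H H (P ⊗ₜ[k] Q))) := by
  simp only [hatCoaction, LinearMap.comp_apply, TensorProduct.map_tmul]
  induction P with
  | zero => simp [coactionFromR_zero]
  | add P P' hP hP' => simp only [coactionFromR_add, map_add, TensorProduct.add_tmul, hP, hP']
  | tmul a b =>
    induction Q with
    | zero => simp [coactionFromR_zero]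
    | add Q Q' hQ hQ' => simp only [coactionFromR_add, map_add, TensorProduct.tmul_add, hQ, hQ']
    | tmul c d => simp [coactionFromR_tmul, actOnPair, ttc, ← hμ]

/-- for modules over a quasitriangular Hom-bialgebra (with `αH` bijective and
`(α ⊗ α)(R) = R`), the R-matrix coaction on `M ⊗ N` coincides with the ⊗̂ coaction built
from the R-matrix coactions of `M` and `N`. -/
theorem stmt12 {k H M N : Type*} [Field k]
    [AddCommGroup H] [Module k H] [AddCommGroup M] [Module k M] [AddCommGroup N] [Module k N]
    (μ : H ⊗[k] H →ₗ[k] H) (Δ : H →ₗ[k] H ⊗[k] H) (αH : H ≃ₗ[k] H) (R : H ⊗[k] H)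
    (hQT : IsQuasitriangular k μ Δ αH.toLinearMap R)
    (hR : TensorProduct.map αH.toLinearMap αH.toLinearMap R = R)
    (ρM : H ⊗[k] M →ₗ[k] M) (αM : M →ₗ[k] M)
    (hM : IsHomModule k μ αH.toLinearMap ρM αM)
    (ρN : H ⊗[k] N →ₗ[k] N) (αN : N →ₗ[k] N)
    (hN : IsHomModule k μ αH.toLinearMap ρN αN) :
    hatCoaction k μ αH.symm.toLinearMap (coactionFromR k R αH.toLinearMap ρM)
        (coactionFromR k R αH.toLinearMap ρN)
      = coactionFromR k R αH.toLinearMap (hatAction k Δ ρM ρN) := by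
  obtain ⟨hH, hΔ, -, -⟩ := hQT
  refine TensorProduct.ext' fun m n => ?_
  have h := hatCoaction_coactionFromR_map k μ αH hH.mul_mult ρM ρN R R m n
  rw [hR] at h
  rw [h, coactionFromR_hatAction, hΔ]

end HomYD
end
end
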